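/- Let A_1, …, A_n be nonempty finite subsets of ℝ^n. Then MV(conv(A_1), …, conv(A_n)) ≠ 0 if and only if there exist points a_i, b_i ∈ A_i for i = 1, …, n such that the n vectors b_1 − a_1, …, b_n − a_n are linearly independent over ℝ. -/

import Mathlib

open Pointwise MeasureTheory

/-- The mixed volume of `n` compact convex bodies in `ℝⁿ`, via
inclusion–exclusion on volumes of Minkowski sums. -/
noncomputable def mixedVol (n : ℕ) (C : Fin n → Set (Fin n → ℝ)) : ℝ :=
  ∑ S : Finset (Fin n), (-1 : ℝ) ^ (n - S.card) * (volume (∑ i ∈ S, C i)).toReal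

section Helpers

open Finset Matrix

section Polarization

variable {ι R : Type*} [Fintype ι] [DecidableEq ι] [CommRing R]

lemma sum_neg_one_pow_mul_ite_subset (T : Finset ι) :
    ∑ S : Finset ι, (-1 : R) ^ (Fintype.card ι - #S) * (if T ⊆ S then 1 else 0) =
      if T = univ then 1 else 0 := by
  have h := prod_add (fun _ : ι ↦ (1 : R)) (fun i ↦ if i ∈ T then 0 else -1) univ
  have hl : ∏ i : ι, ((1 : R) + if i ∈ T then 0 else -1) = if T = univ then 1 else 0 := by
    have : ∀ i, ((1 : R) + if i ∈ T then 0 else -1) = if i ∈ T then 1 else 0 := by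
      intro i; split_ifs <;> simp
    simp_rw [this, Finset.prod_ite_zero, prod_const_one, mem_univ, true_imp_iff, eq_univ_iff_forall]
  rw [← hl, h, powerset_univ]
  refine sum_congr rfl fun S _ ↦ ?_
  have : ∀ i, (if i ∈ T then (0 : R) else -1) = if i ∉ T then -1 else 0 := by
    intro i; split_ifs <;> simp_all
  simp_rw [prod_const_one, one_mul, this, Finset.prod_ite_zero, prod_const, mul_ite, mul_one,
    mul_zero]
  rw [← compl_eq_univ_sdiff, card_compl]
  congr 1
  simp only [mem_compl, subset_iff, eq_iff_iff]
  exact forall_congr' fun i ↦ not_imp_not.symm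

/-- The polarization of the determinant as a sum over permutations. -/
lemma sum_neg_one_pow_mul_det_sum (H : ι → Matrix ι ι R) :
    ∑ S : Finset ι, (-1 : R) ^ (Fintype.card ι - #S) * (∑ i ∈ S, H i).det =
      ∑ σ : Equiv.Perm ι, (Matrix.of fun r ↦ H (σ r) r).det := by
  have hdet (S : Finset ι) : (∑ i ∈ S, H i).det =
      ∑ f : ι → ι, (if univ.image f ⊆ S then 1 else 0) * (Matrix.of fun r ↦ H (f r) r).det := by
    have h := (detRowAlternating (R := R) (n := ι)).toMultilinearMap.map_sum_finset
      (fun r i ↦ H i r) (fun _ ↦ S)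
    have hrow : (∑ i ∈ S, H i) = fun r ↦ ∑ i ∈ S, H i r := by
      ext r c; simp [Matrix.sum_apply]
    rw [hrow]
    refine h.trans ?_
    simp_rw [ite_mul, one_mul, zero_mul]
    rw [← sum_filter]
    refine sum_congr ?_ fun f _ ↦ rfl
    ext f
    simp [Fintype.mem_piFinset, image_subset_iff]
  simp_rw [hdet, mul_sum]
  rw [sum_comm]
  simp_rw [← mul_assoc, ← sum_mul, sum_neg_one_pow_mul_ite_subset]
  symm
  refine Fintype.sum_of_injective (fun σ : Equiv.Perm ι ↦ (σ : ι → ι)) DFunLike.coe_injective _ _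
    (fun f hf ↦ ?_) (fun σ ↦ ?_)
  · rw [if_neg, zero_mul]
    intro h
    have hs : Function.Surjective f := by
      intro y
      have : y ∈ univ.image f := by rw [h]; exact mem_univ y
      simpa using this
    exact hf ⟨Equiv.ofBijective f (Finite.surjective_iff_bijective.1 hs), rfl⟩
  · rw [if_pos (image_univ_of_surjective σ.surjective), one_mul]

/-- The polarized determinant of linear combinations of rank one matrices is a
linear combination of squares of determinants. -/
lemma sum_neg_one_pow_mul_det_sum_vecMulVec {κ : Type*} (K : ι → Finset κ) (w : ι → κ → R)
    (v : ι → κ → ι → R) :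
    ∑ S : Finset ι, (-1 : R) ^ (Fintype.card ι - #S) *
        (∑ i ∈ S, ∑ k ∈ K i, w i k • vecMulVec (v i k) (v i k)).det =
      ∑ k ∈ Fintype.piFinset K, (∏ i, w i (k i)) * (Matrix.of fun i ↦ v i (k i)).det ^ 2 := by
  classical
  obtain ⟨H, hH⟩ : ∃ H : ι → Matrix ι ι R,
      ∀ i, H i = ∑ k ∈ K i, w i k • vecMulVec (v i k) (v i k) := ⟨_, fun _ ↦ rfl⟩
  simp_rw [← hH]
  rw [sum_neg_one_pow_mul_det_sum]
  have hperm (σ : Equiv.Perm ι) : (Matrix.of fun r ↦ H (σ r) r).det =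
      (Equiv.Perm.sign σ⁻¹ : R) * (Matrix.of fun i ↦ H i (σ⁻¹ i)).det := by
    have := det_permute σ (Matrix.of fun i ↦ H i (σ⁻¹ i))
    rw [Equiv.Perm.sign_inv, ← this]
    congr 1
    ext r c
    simp
  have hrow (σ : Equiv.Perm ι) : (Matrix.of fun i ↦ H i (σ i)).det =
      ∑ k ∈ Fintype.piFinset K, (∏ i, w i (k i)) * (∏ i, v i (k i) (σ i)) *
        (Matrix.of fun i ↦ v i (k i)).det := by
    have h := (detRowAlternating (R := R) (n := ι)).toMultilinearMap.map_sum_finset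
      (fun i k ↦ (w i k * v i k (σ i)) • v i k) K
    have hr : (Matrix.of fun i ↦ H i (σ i)) =
        fun i ↦ ∑ k ∈ K i, (w i k * v i k (σ i)) • v i k := by
      ext r c
      simp [hH, Matrix.sum_apply, vecMulVec_apply, mul_assoc]
    rw [hr]
    refine h.trans (sum_congr rfl fun k _ ↦ ?_)
    rw [MultilinearMap.map_smul_univ, prod_mul_distrib, smul_eq_mul]
    rfl
  simp_rw [hperm]
  refine (Equiv.sum_comp (Equiv.inv (Equiv.Perm ι))
    (fun σ ↦ (Equiv.Perm.sign σ : R) * (Matrix.of fun i ↦ H i (σ i)).det)).trans ?_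
  simp_rw [hrow, mul_sum]
  rw [sum_comm]
  refine sum_congr rfl fun k _ ↦ ?_
  have hdet : (Matrix.of fun i ↦ v i (k i)).det =
      ∑ σ : Equiv.Perm ι, (Equiv.Perm.sign σ : R) * ∏ i, v i (k i) (σ i) := by
    rw [← det_transpose, det_apply']
    rfl
  calc
    _ = (∏ i, w i (k i)) * (Matrix.of fun i ↦ v i (k i)).det *
        ∑ σ : Equiv.Perm ι, (Equiv.Perm.sign σ : R) * ∏ i, v i (k i) (σ i) := by
      rw [mul_sum]
      exact sum_congr rfl fun σ _ ↦ by ring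
    _ = _ := by rw [← hdet, sq, mul_assoc]

end Polarization

noncomputable section Gibbs

variable {m : Type*} [Fintype m]

/-- The continuous linear functional `x ↦ a ⬝ᵥ x`. -/
def dotCLM (a : m → ℝ) : (m → ℝ) →L[ℝ] ℝ :=
  LinearMap.toContinuousLinearMap (dotProductBilin ℝ ℝ a)

@[simp] lemma dotCLM_apply (a x : m → ℝ) : dotCLM a x = a ⬝ᵥ x := rfl

/-- The log-partition function of a finite set of vectors. -/
def logPartition (s : Finset (m → ℝ)) (x : m → ℝ) : ℝ :=
  Real.log (∑ a ∈ s, Real.exp (a ⬝ᵥ x))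

/-- The Gibbs weight of the vector `a`. -/
def gibbsWeight (s : Finset (m → ℝ)) (x a : m → ℝ) : ℝ :=
  Real.exp (a ⬝ᵥ x - logPartition s x)

/-- The mean of the Gibbs distribution on `s`. -/
def gibbsMean (s : Finset (m → ℝ)) (x : m → ℝ) : m → ℝ :=
  ∑ a ∈ s, gibbsWeight s x a • a

/-- The covariance matrix of the Gibbs distribution on `s`. -/
def gibbsCov (s : Finset (m → ℝ)) (x : m → ℝ) : Matrix m m ℝ :=
  ∑ p ∈ s ×ˢ s, (gibbsWeight s x p.1 * gibbsWeight s x p.2 / 2) •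
    vecMulVec (p.2 - p.1) (p.2 - p.1)

variable {s : Finset (m → ℝ)}

lemma gibbsWeight_pos (x a : m → ℝ) : 0 < gibbsWeight s x a := Real.exp_pos _

lemma sum_exp_pos (hs : s.Nonempty) (x : m → ℝ) : 0 < ∑ a ∈ s, Real.exp (a ⬝ᵥ x) :=
  sum_pos (fun _ _ ↦ Real.exp_pos _) hs

lemma gibbsWeight_eq (hs : s.Nonempty) (x a : m → ℝ) :
    gibbsWeight s x a = Real.exp (a ⬝ᵥ x) / ∑ a ∈ s, Real.exp (a ⬝ᵥ x) := by
  rw [gibbsWeight, logPartition, Real.exp_sub, Real.exp_log (sum_exp_pos hs x)]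

lemma sum_gibbsWeight (hs : s.Nonempty) (x : m → ℝ) : ∑ a ∈ s, gibbsWeight s x a = 1 := by
  simp_rw [gibbsWeight_eq hs, ← sum_div]
  exact div_self (sum_exp_pos hs x).ne'

lemma dotProduct_le_logPartition {a : m → ℝ} (ha : a ∈ s) (x : m → ℝ) :
    a ⬝ᵥ x ≤ logPartition s x := by
  rw [logPartition, Real.le_log_iff_exp_le (sum_exp_pos ⟨a, ha⟩ x)]
  exact single_le_sum (f := fun a : m → ℝ ↦ Real.exp (a ⬝ᵥ x))
    (fun _ _ ↦ (Real.exp_pos _).le) ha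

lemma dotProduct_le_logPartition_of_mem_convexHull {z : m → ℝ}
    (hz : z ∈ convexHull ℝ (s : Set (m → ℝ))) (x : m → ℝ) :
    z ⬝ᵥ x ≤ logPartition s x := by
  have hc : Convex ℝ {z : m → ℝ | z ⬝ᵥ x ≤ logPartition s x} :=
    convex_halfSpace_le ⟨fun a b ↦ add_dotProduct a b x, fun c a ↦ smul_dotProduct c a x⟩ _
  exact convexHull_min (fun a ha ↦ dotProduct_le_logPartition ha x) hc hz

lemma gibbsMean_mem_convexHull (hs : s.Nonempty) (x : m → ℝ) :
    gibbsMean s x ∈ convexHull ℝ (s : Set (m → ℝ)) :=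
  (convex_convexHull ℝ _).sum_mem (fun a _ ↦ (gibbsWeight_pos x a).le) (sum_gibbsWeight hs x)
    fun _ ha ↦ subset_convexHull ℝ _ ha

lemma hasFDerivAt_logPartition (hs : s.Nonempty) (x : m → ℝ) :
    HasFDerivAt (logPartition s) (dotCLM (gibbsMean s x)) x := by
  have h := (HasFDerivAt.fun_sum (u := s) (x := x)
    fun a _ ↦ ((dotCLM a).hasFDerivAt (x := x)).exp).log (sum_exp_pos hs x).ne'
  refine h.congr_fderiv ?_
  ext v
  simp only [dotCLM_apply, gibbsMean, sum_dotProduct, smul_dotProduct, gibbsWeight_eq hs,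
    FunLike.coe_smul, Pi.smul_apply, _root_.sum_apply, smul_eq_mul, mul_sum]
  exact sum_congr rfl fun a _ ↦ by ring

lemma continuous_logPartition (hs : s.Nonempty) : Continuous (logPartition s) :=
  continuous_iff_continuousAt.2 fun x ↦ (hasFDerivAt_logPartition hs x).continuousAt

lemma hasFDerivAt_gibbsWeight (hs : s.Nonempty) (x a : m → ℝ) :
    HasFDerivAt (fun x ↦ gibbsWeight s x a)
      (gibbsWeight s x a • (dotCLM a - dotCLM (gibbsMean s x))) x :=
  (((dotCLM a).hasFDerivAt (x := x)).sub (hasFDerivAt_logPartition hs x)).exp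

lemma gibbsCov_mulVec (x v : m → ℝ) :
    gibbsCov s x *ᵥ v = ∑ p ∈ s ×ˢ s, (gibbsWeight s x p.1 * gibbsWeight s x p.2 / 2 *
      ((p.2 - p.1) ⬝ᵥ v)) • (p.2 - p.1) := by
  rw [gibbsCov, sum_mulVec]
  refine sum_congr rfl fun p _ ↦ ?_
  rw [smul_mulVec, vecMulVec_mulVec, op_smul_eq_smul, smul_smul]

lemma gibbsCov_mulVec_eq (hs : s.Nonempty) (x v : m → ℝ) :
    gibbsCov s x *ᵥ v =
      ∑ a ∈ s, (gibbsWeight s x a * (a ⬝ᵥ v - gibbsMean s x ⬝ᵥ v)) • a := by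
  rw [gibbsCov_mulVec, sum_product]
  set w := gibbsWeight s x
  have hw : ∑ a ∈ s, w a = 1 := sum_gibbsWeight hs x
  have hmean : gibbsMean s x ⬝ᵥ v = ∑ a ∈ s, w a * (a ⬝ᵥ v) := by
    simp [gibbsMean, sum_dotProduct, w]
  have hsplit : ∀ a b : m → ℝ, (w a * w b / 2 * ((b - a) ⬝ᵥ v)) • (b - a) =
      ((1 / 2 : ℝ) • (w a • (w b * (b ⬝ᵥ v)) • b) - (1 / 2 : ℝ) • ((w a * (a ⬝ᵥ v)) • w b • b)) +
      ((1 / 2 : ℝ) • (w b • (w a * (a ⬝ᵥ v)) • a) - (1 / 2 : ℝ) • ((w b * (b ⬝ᵥ v)) • w a • a)) := by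
    intro a b
    rw [sub_dotProduct]
    module
  have hone : ∑ a ∈ s, ∑ b ∈ s, ((1 / 2 : ℝ) • (w a • (w b * (b ⬝ᵥ v)) • b) -
      (1 / 2 : ℝ) • ((w a * (a ⬝ᵥ v)) • w b • b)) =
      (1 / 2 : ℝ) • ∑ a ∈ s, (w a * (a ⬝ᵥ v - gibbsMean s x ⬝ᵥ v)) • a := by
    simp_rw [sum_sub_distrib, ← smul_sum, ← sum_smul, hw, ← hmean, one_smul]
    simp_rw [mul_sub, sub_smul, sum_sub_distrib, smul_sub, gibbsMean, mul_comm (w _), mul_smul,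
      smul_sum]
  simp_rw [hsplit, sum_add_distrib]
  rw [hone, sum_comm, hone, ← add_smul]
  norm_num

lemma dotProduct_gibbsCov_mulVec (x v : m → ℝ) :
    v ⬝ᵥ gibbsCov s x *ᵥ v = ∑ p ∈ s ×ˢ s,
      gibbsWeight s x p.1 * gibbsWeight s x p.2 / 2 * ((p.2 - p.1) ⬝ᵥ v) ^ 2 := by
  rw [gibbsCov_mulVec, dotProduct_sum]
  refine sum_congr rfl fun p _ ↦ ?_
  rw [dotProduct_smul, dotProduct_comm v, smul_eq_mul]
  ring

lemma dotProduct_gibbsCov_mulVec_nonneg (x v : m → ℝ) : 0 ≤ v ⬝ᵥ gibbsCov s x *ᵥ v := by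
  rw [dotProduct_gibbsCov_mulVec]
  refine sum_nonneg fun p _ ↦ ?_
  have := gibbsWeight_pos (s := s) x p.1
  have := gibbsWeight_pos (s := s) x p.2
  positivity

lemma dotProduct_gibbsCov_mulVec_eq_zero_iff (x v : m → ℝ) :
    v ⬝ᵥ gibbsCov s x *ᵥ v = 0 ↔ ∀ a ∈ s, ∀ b ∈ s, (b - a) ⬝ᵥ v = 0 := by
  have hpos (p : (m → ℝ) × (m → ℝ)) :
      0 < gibbsWeight s x p.1 * gibbsWeight s x p.2 / 2 := by
    have := gibbsWeight_pos (s := s) x p.1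
    have := gibbsWeight_pos (s := s) x p.2
    positivity
  rw [dotProduct_gibbsCov_mulVec,
    sum_eq_zero_iff_of_nonneg fun p _ ↦ mul_nonneg (hpos p).le (sq_nonneg _)]
  simp_rw [mul_eq_zero, (hpos _).ne', false_or, sq_eq_zero_iff, mem_product]
  exact ⟨fun h a ha b hb ↦ h (a, b) ⟨ha, hb⟩, fun h p hp ↦ h _ hp.1 _ hp.2⟩

lemma gibbsCov_posSemidef (x : m → ℝ) : (gibbsCov s x).PosSemidef := by
  refine posSemidef_sum _ fun p _ ↦ PosSemidef.smul ?_ ?_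
  · simpa using posSemidef_vecMulVec_self_star (p.2 - p.1)
  · have := gibbsWeight_pos (s := s) x p.1
    have := gibbsWeight_pos (s := s) x p.2
    positivity

variable [DecidableEq m]

lemma hasFDerivAt_gibbsMean (hs : s.Nonempty) (x : m → ℝ) :
    HasFDerivAt (gibbsMean s) (LinearMap.toContinuousLinearMap (toLin' (gibbsCov s x))) x := by
  have h := HasFDerivAt.fun_sum (u := s) (x := x)
    fun a _ ↦ (hasFDerivAt_gibbsWeight hs x a).smul_const a
  refine h.congr_fderiv ?_
  ext1 v
  simp only [LinearMap.coe_toContinuousLinearMap', toLin'_apply, gibbsCov_mulVec_eq hs]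
  simp

end Gibbs

section Volume

variable {ι m : Type*} [Fintype m] {t : Finset ι} {B : ι → Finset (m → ℝ)}

omit [Fintype m] in
lemma convex_sum_convexHull : Convex ℝ (∑ i ∈ t, convexHull ℝ (B i : Set (m → ℝ))) := by
  rw [← convexHull_sum]
  exact convex_convexHull ℝ _

lemma isCompact_sum_convexHull :
    IsCompact (∑ i ∈ t, convexHull ℝ (B i : Set (m → ℝ))) := by
  classical
  rw [← convexHull_sum, ← coe_sum]
  exact (finite_toSet _).isCompact_convexHull ℝ

lemma sum_gibbsMean_mem (hB : ∀ i, (B i).Nonempty) (x : m → ℝ) :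
    ∑ i ∈ t, gibbsMean (B i) x ∈ ∑ i ∈ t, convexHull ℝ (B i : Set (m → ℝ)) :=
  Set.finsetSum_mem_finsetSum _ _ _ fun i _ ↦ gibbsMean_mem_convexHull (hB i) x

lemma dotProduct_le_sum_logPartition {z : m → ℝ}
    (hz : z ∈ ∑ i ∈ t, convexHull ℝ (B i : Set (m → ℝ))) (x : m → ℝ) :
    z ⬝ᵥ x ≤ ∑ i ∈ t, logPartition (B i) x := by
  obtain ⟨g, hg, rfl⟩ := (Set.mem_finsetSum _ _ _).1 hz
  rw [sum_dotProduct]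
  exact sum_le_sum fun i hi ↦ dotProduct_le_logPartition_of_mem_convexHull (hg hi) x

lemma interior_subset_range_sum_gibbsMean (hB : ∀ i, (B i).Nonempty) :
    interior (∑ i ∈ t, convexHull ℝ (B i : Set (m → ℝ))) ⊆
      Set.range fun x ↦ ∑ i ∈ t, gibbsMean (B i) x := by
  classical
  intro y hy
  obtain ⟨ε, hε, hball⟩ := Metric.nhds_basis_closedBall.mem_iff.1 (mem_interior_iff_mem_nhds.1 hy)
  set g : (m → ℝ) → ℝ := fun x ↦ ∑ i ∈ t, logPartition (B i) x - y ⬝ᵥ x with hg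
  have hcont : Continuous g :=
    (continuous_finsetSum _ fun i _ ↦ continuous_logPartition (hB i)).sub (dotCLM y).continuous
  have hle (z : m → ℝ) (hz : ‖z‖ ≤ ε) (x : m → ℝ) : z ⬝ᵥ x ≤ g x := by
    have := dotProduct_le_sum_logPartition (z := y + z) (hball (by simpa using hz)) x
    rw [add_dotProduct] at this
    simp only [hg]
    linarith
  have hgrowth (x : m → ℝ) : ε * ‖x‖ ≤ g x := by
    have h0 : 0 ≤ g x := by simpa using hle 0 (by simpa using hε.le) x
    rw [← le_div_iff₀' hε, pi_norm_le_iff_of_nonneg (by positivity)]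
    intro j
    rw [le_div_iff₀' hε]
    have h1 := hle (Pi.single j ε) (by simp [Pi.norm_single, abs_of_pos hε]) x
    have h2 := hle (Pi.single j (-ε)) (by simp [Pi.norm_single, abs_of_pos hε]) x
    rw [single_dotProduct] at h1 h2
    rw [Real.norm_eq_abs]
    rcases abs_cases (x j) with h | h <;> rw [h.1] <;> linarith
  have htend : Filter.Tendsto g (Filter.cocompact _) Filter.atTop :=
    Filter.tendsto_atTop_mono hgrowth
      (tendsto_norm_cocompact_atTop.const_mul_atTop hε)
  obtain ⟨x, hx⟩ := hcont.exists_forall_le htend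
  have hderiv : HasFDerivAt g (∑ i ∈ t, dotCLM (gibbsMean (B i) x) - dotCLM y) x :=
    (HasFDerivAt.fun_sum fun i _ ↦ hasFDerivAt_logPartition (hB i) x).sub
      (dotCLM y).hasFDerivAt
  have hmin : IsLocalMin g x := .of_forall hx
  have hzero := hmin.hasFDerivAt_eq_zero hderiv
  refine ⟨x, ?_⟩
  ext j
  have := DFunLike.congr_fun hzero (Pi.single j 1)
  simp [_root_.sum_apply, sub_eq_zero] at this
  simpa using this

variable [DecidableEq m]

lemma hasFDerivAt_sum_gibbsMean (hB : ∀ i, (B i).Nonempty) (x : m → ℝ) :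
    HasFDerivAt (fun x ↦ ∑ i ∈ t, gibbsMean (B i) x)
      (LinearMap.toContinuousLinearMap (toLin' (∑ i ∈ t, gibbsCov (B i) x))) x := by
  refine (HasFDerivAt.fun_sum fun i _ ↦ hasFDerivAt_gibbsMean (hB i) x).congr_fderiv ?_
  simp only [map_sum]

lemma injective_sum_gibbsMean (hB : ∀ i, (B i).Nonempty)
    (hnd : ∀ v : m → ℝ, (∀ i ∈ t, ∀ a ∈ B i, ∀ b ∈ B i, (b - a) ⬝ᵥ v = 0) → v = 0) :
    Function.Injective fun x ↦ ∑ i ∈ t, gibbsMean (B i) x := by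
  intro x y hxy
  by_contra hne
  set v := x - y
  have hv : v ≠ 0 := sub_ne_zero.2 hne
  have hderiv (r : ℝ) : HasDerivAt
      (fun r : ℝ ↦ v ⬝ᵥ ∑ i ∈ t, gibbsMean (B i) (y + r • v))
      (v ⬝ᵥ (∑ i ∈ t, gibbsCov (B i) (y + r • v)) *ᵥ v) r := by
    have hline : HasDerivAt (fun r : ℝ ↦ y + r • v) v r := by
      simpa using ((hasDerivAt_id r).smul_const v).const_add y
    have hcomp := (hasFDerivAt_sum_gibbsMean (t := t) hB (y + r • v)).comp_hasDerivAt r hline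
    exact (dotCLM v).hasFDerivAt.comp_hasDerivAt r hcomp
  have hmono : StrictMono fun r : ℝ ↦ v ⬝ᵥ ∑ i ∈ t, gibbsMean (B i) (y + r • v) := by
    refine strictMono_of_deriv_pos fun r ↦ ?_
    rw [(hderiv r).deriv, sum_mulVec, dotProduct_sum]
    refine (sum_nonneg fun i _ ↦ dotProduct_gibbsCov_mulVec_nonneg _ _).lt_of_ne' fun h ↦ hv ?_
    rw [sum_eq_zero_iff_of_nonneg fun i _ ↦ dotProduct_gibbsCov_mulVec_nonneg _ _] at h
    exact hnd v fun i hi ↦ (dotProduct_gibbsCov_mulVec_eq_zero_iff _ _).1 (h i hi)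
  have h01 := hmono (zero_lt_one' ℝ)
  simp only [zero_smul, add_zero, one_smul, v, add_sub_cancel] at h01
  simp only at hxy
  rw [hxy] at h01
  exact h01.false

/-- The volume of a Minkowski sum of polytopes is the integral of the Jacobian
determinant of the associated sum of moment maps. -/
lemma integrable_and_integral_det_sum_gibbsCov (hB : ∀ i, (B i).Nonempty) :
    Integrable (fun x ↦ (∑ i ∈ t, gibbsCov (B i) x).det) ∧
      ∫ x, (∑ i ∈ t, gibbsCov (B i) x).det =
        (volume (∑ i ∈ t, convexHull ℝ (B i : Set (m → ℝ)))).toReal := by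
  set P := ∑ i ∈ t, convexHull ℝ (B i : Set (m → ℝ))
  have hint : volume (interior P) = volume P := by
    refine measure_interior_of_null_frontier ?_
    exact convex_sum_convexHull.addHaar_frontier volume
  by_cases hnd : ∀ v : m → ℝ, (∀ i ∈ t, ∀ a ∈ B i, ∀ b ∈ B i, (b - a) ⬝ᵥ v = 0) → v = 0
  · set F := fun x ↦ ∑ i ∈ t, gibbsMean (B i) x
    have hinj : Set.InjOn F Set.univ := (injective_sum_gibbsMean hB hnd).injOn
    have hvol : volume (F '' Set.univ) = volume P := by
      rw [Set.image_univ]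
      refine le_antisymm (measure_mono (Set.range_subset_iff.2 (sum_gibbsMean_mem hB))) ?_
      rw [← hint]
      exact measure_mono (interior_subset_range_sum_gibbsMean hB)
    have hderiv (x) (_ : x ∈ Set.univ) := (hasFDerivAt_sum_gibbsMean (t := t) hB x).hasFDerivWithinAt
      (s := Set.univ)
    have hdet (x : m → ℝ) : |(LinearMap.toContinuousLinearMap
        (toLin' (∑ i ∈ t, gibbsCov (B i) x))).det| • (1 : ℝ) =
        (∑ i ∈ t, gibbsCov (B i) x).det := by
      rw [LinearMap.det_toContinuousLinearMap, LinearMap.det_toLin', smul_eq_mul, mul_one,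
        abs_of_nonneg (posSemidef_sum _ fun i _ ↦ gibbsCov_posSemidef x).det_nonneg]
    have h1 := integrableOn_image_iff_integrableOn_abs_det_fderiv_smul volume MeasurableSet.univ
      hderiv hinj (fun _ ↦ (1 : ℝ))
    have h2 := integral_image_eq_integral_abs_det_fderiv_smul volume MeasurableSet.univ
      hderiv hinj (fun _ ↦ (1 : ℝ))
    simp_rw [hdet] at h1 h2
    rw [integrableOn_univ] at h1
    rw [setIntegral_univ] at h2
    refine ⟨h1.1 (integrableOn_const ?_), ?_⟩
    · rw [hvol]
      exact isCompact_sum_convexHull.measure_lt_top.ne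
    · rw [← h2, setIntegral_const, smul_eq_mul, mul_one, measureReal_def, hvol]
  · push Not at hnd
    obtain ⟨v, hv, hv0⟩ := hnd
    have hdet (x : m → ℝ) : (∑ i ∈ t, gibbsCov (B i) x).det = 0 := by
      refine exists_mulVec_eq_zero_iff.1 ⟨v, hv0, ?_⟩
      rw [sum_mulVec]
      refine sum_eq_zero fun i hi ↦ ?_
      rw [gibbsCov_mulVec]
      refine sum_eq_zero fun p hp ↦ ?_
      rw [mem_product] at hp
      rw [hv i hi _ hp.1 _ hp.2, mul_zero, zero_smul]
    have hflat (z : m → ℝ) (hz : z ∈ P) : z ⬝ᵥ v = ∑ i ∈ t, (hB i).choose ⬝ᵥ v := by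
      obtain ⟨g, hg, rfl⟩ := (Set.mem_finsetSum _ _ _).1 hz
      rw [sum_dotProduct]
      refine sum_congr rfl fun i hi ↦ ?_
      have hc : Convex ℝ {z : m → ℝ | z ⬝ᵥ v = (hB i).choose ⬝ᵥ v} :=
        convex_hyperplane ⟨fun a b ↦ add_dotProduct a b v, fun c a ↦ smul_dotProduct c a v⟩ _
      refine convexHull_min (fun a ha ↦ ?_) hc (hg hi)
      have := hv i hi _ (hB i).choose_spec a ha
      rwa [sub_dotProduct, sub_eq_zero] at this
    have hempty : interior P = ∅ := by
      refine Set.eq_empty_of_forall_notMem fun y hy ↦ ?_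
      have hline : Filter.Tendsto (fun r : ℝ ↦ y + r • v) (nhds 0) (nhds y) := by
        have : Continuous fun r : ℝ ↦ y + r • v := by fun_prop
        simpa using this.tendsto 0
      have hev := hline.eventually (mem_interior_iff_mem_nhds.1 hy)
      obtain ⟨r, hr, hr0⟩ := ((hev.filter_mono nhdsWithin_le_nhds).and
        (self_mem_nhdsWithin (s := {(0 : ℝ)}ᶜ))).exists
      have := (hflat _ hr).trans (hflat y (interior_subset hy)).symm
      rw [add_dotProduct, add_eq_left, smul_dotProduct, smul_eq_mul, mul_eq_zero,
        dotProduct_self_eq_zero] at this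
      exact this.elim hr0 hv0
    simp_rw [hdet]
    rw [← hint, hempty]
    simp

end Volume

/-- The mixed discriminant of the Gibbs covariance matrices of `B`, whose integral is
the mixed volume of the convex hulls. -/
noncomputable def mixedDensity {n : ℕ} (B : Fin n → Finset (Fin n → ℝ)) (x : Fin n → ℝ) : ℝ :=
  ∑ k ∈ Fintype.piFinset fun i ↦ B i ×ˢ B i,
    (∏ i, (gibbsWeight (B i) x (k i).1 * gibbsWeight (B i) x (k i).2 / 2)) *
      (Matrix.of fun i ↦ (k i).2 - (k i).1).det ^ 2

/-- The mixed volume of polytopes is the integral of a mixed discriminant. -/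
lemma integral_eq_mixedVol {n : ℕ} {B : Fin n → Finset (Fin n → ℝ)}
    (hB : ∀ i, (B i).Nonempty) :
    Integrable (mixedDensity B) ∧
      ∫ x, mixedDensity B x = mixedVol n fun i ↦ convexHull ℝ (B i : Set (Fin n → ℝ)) := by
  have hden : mixedDensity B = fun x ↦ ∑ S : Finset (Fin n), (-1 : ℝ) ^ (n - #S) *
      (∑ i ∈ S, gibbsCov (B i) x).det := by
    ext x
    have h := sum_neg_one_pow_mul_det_sum_vecMulVec (fun i ↦ B i ×ˢ B i)
      (fun i p ↦ gibbsWeight (B i) x p.1 * gibbsWeight (B i) x p.2 / 2) (fun _ p ↦ p.2 - p.1)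
    rw [Fintype.card_fin] at h
    exact h.symm
  have hint (S : Finset (Fin n)) := integrable_and_integral_det_sum_gibbsCov (t := S) hB
  rw [hden]
  refine ⟨integrable_finsetSum _ fun S _ ↦ (hint S).1.const_mul _, ?_⟩
  rw [integral_finsetSum _ fun S _ ↦ (hint S).1.const_mul _, mixedVol]
  exact sum_congr rfl fun S _ ↦ by rw [integral_const_mul, (hint S).2]

lemma mixedVol_convexHull_ne_zero_iff {n : ℕ} {B : Fin n → Finset (Fin n → ℝ)}
    (hB : ∀ i, (B i).Nonempty) :
    mixedVol n (fun i ↦ convexHull ℝ (B i : Set (Fin n → ℝ))) ≠ 0 ↔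
      ∃ a b : Fin n → Fin n → ℝ, (∀ i, a i ∈ B i) ∧ (∀ i, b i ∈ B i) ∧
        LinearIndependent ℝ fun i ↦ b i - a i := by
  obtain ⟨hint, hvol⟩ := integral_eq_mixedVol hB
  have hw (x : Fin n → ℝ) (k : Fin n → (Fin n → ℝ) × (Fin n → ℝ)) :
      0 < ∏ i, (gibbsWeight (B i) x (k i).1 * gibbsWeight (B i) x (k i).2 / 2) :=
    prod_pos fun i _ ↦ half_pos (mul_pos (gibbsWeight_pos _ _) (gibbsWeight_pos _ _))
  have hli (M : Fin n → Fin n → ℝ) : LinearIndependent ℝ M ↔ (Matrix.of M).det ≠ 0 := by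
    rw [← isUnit_iff_ne_zero, ← isUnit_iff_isUnit_det, ← linearIndependent_rows_iff_isUnit]
    rfl
  rw [← hvol]
  refine ⟨fun h ↦ ?_, fun ⟨a, b, ha, hb, hab⟩ ↦ ?_⟩
  · contrapose! h
    have hzero : mixedDensity B = 0 := by
      ext x
      refine sum_eq_zero fun k hk ↦ ?_
      simp only [Fintype.mem_piFinset, mem_product] at hk
      have := h (fun i ↦ (k i).1) (fun i ↦ (k i).2) (fun i ↦ (hk i).1) fun i ↦ (hk i).2
      rw [hli, not_not] at this
      rw [this]
      ring
    simp [hzero]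
  · have hnonneg : 0 ≤ mixedDensity B := fun x ↦
      sum_nonneg fun k _ ↦ mul_nonneg (hw x k).le (sq_nonneg _)
    have hpos (x : Fin n → ℝ) : 0 < mixedDensity B x := by
      refine sum_pos' (fun k _ ↦ mul_nonneg (hw x k).le (sq_nonneg _))
        ⟨fun i ↦ (a i, b i), ?_, mul_pos (hw x _) (sq_pos_of_ne_zero ((hli _).1 hab))⟩
      simp [Fintype.mem_piFinset, ha, hb]
    refine ((integral_pos_iff_support_of_nonneg hnonneg hint).2 ?_).ne'
    rw [Function.support_eq_univ fun x ↦ (hpos x).ne']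
    exact NeZero.pos _

end Helpers

/-- `MV(conv(A₁),…,conv(Aₙ)) ≠ 0` iff one can pick `aᵢ, bᵢ ∈ Aᵢ` such
that the differences `bᵢ − aᵢ` are linearly independent (i.e. a mixed cell
candidate exists). -/
theorem mixedVol_ne_zero_iff (n : ℕ) (A : Fin n → Set (Fin n → ℝ))
    (hfin : ∀ i, (A i).Finite) (hne : ∀ i, (A i).Nonempty) :
    mixedVol n (fun i => convexHull ℝ (A i)) ≠ 0 ↔
      ∃ a b : ∀ _ : Fin n, Fin n → ℝ, (∀ i, a i ∈ A i) ∧ (∀ i, b i ∈ A i) ∧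
        LinearIndependent ℝ (fun i => b i - a i) := by
  have h := mixedVol_convexHull_ne_zero_iff (B := fun i ↦ (hfin i).toFinset)
    fun i ↦ (hfin i).toFinset_nonempty.2 (hne i)
  simpa using h
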